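/- For every ν ∈ ℂ and every real α with |α| ≤ π/2: cos(να) = ₂F₁(−ν/2, ν/2; 1/2; sin²α), where the hypergeometric series converges absolutely (also at |α| = π/2, since Re(c−a−b) = 1/2 > 0 there). -/

import Mathlib

open Filter

/-- Pochhammer symbol `(a)ₙ = a(a+1)⋯(a+n-1)` for complex `a`. -/
noncomputable def poch (a : ℂ) (n : ℕ) : ℂ := ∏ k ∈ Finset.range n, (a + k)

/-- Gauss hypergeometric series `₂F₁(a,b;c;x)`. -/
noncomputable def F21 (a b c x : ℂ) : ℂ :=
  ∑' n : ℕ, poch a n * poch b n / (poch c n * n.factorial) * x ^ n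

/-- `D`-dimensional Legendre (Gegenbauer) function `P(z, ν, D)`. -/
noncomputable def legP (z ν : ℂ) (D : ℕ) : ℂ :=
  Complex.Gamma (ν + D - 2) / (Complex.Gamma (ν + 1) * Complex.Gamma ((D : ℂ) - 1)) *
    F21 (-ν) (ν + (D : ℂ) - 2) (((D : ℂ) - 1) / 2) ((1 - z) / 2)

/-- The coefficient of `xⁿ` in `₂F₁(-ν/2, ν/2; 1/2; x)`. -/
noncomputable def cosCoeff (ν : ℂ) (n : ℕ) : ℂ :=
  poch (-ν / 2) n * poch (ν / 2) n / (poch (1 / 2) n * (n.factorial : ℂ))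

lemma poch_succ (a : ℂ) (n : ℕ) : poch a (n + 1) = poch a n * (a + n) := by
  simp [poch, Finset.prod_range_succ]

lemma poch_half_ne_zero (n : ℕ) : poch (1 / 2) n ≠ 0 := by
  refine Finset.prod_ne_zero_iff.2 fun k _ h => ?_
  have := congrArg Complex.re h
  norm_num at this
  have hk : (0 : ℝ) ≤ k := k.cast_nonneg
  linarith

lemma cosCoeff_zero (ν : ℂ) : cosCoeff ν 0 = 1 := by
  simp [cosCoeff, poch]

lemma cosCoeff_succ (ν : ℂ) (n : ℕ) :
    cosCoeff ν (n + 1) * ((2 * n + 2) * (2 * n + 1)) = cosCoeff ν n * (4 * n ^ 2 - ν ^ 2) := by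
  have h1 := poch_half_ne_zero n
  have h2 := poch_half_ne_zero (n + 1)
  have h3 : (n.factorial : ℂ) ≠ 0 := by exact_mod_cast n.factorial_ne_zero
  have h4 : (n + 1 : ℂ) ≠ 0 := by exact_mod_cast n.succ_ne_zero
  rw [poch_succ] at h2
  have h5 := right_ne_zero_of_mul h2
  simp only [cosCoeff, poch_succ, Nat.factorial_succ, Nat.cast_mul, Nat.cast_succ]
  rw [div_mul_eq_mul_div, div_mul_eq_mul_div,
    div_eq_div_iff (mul_ne_zero h2 (mul_ne_zero h4 h3)) (mul_ne_zero h1 h3)]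
  ring

lemma cosCoeff_zero_succ (n : ℕ) : cosCoeff 0 (n + 1) = 0 := by
  have : poch 0 (n + 1) = 0 := by
    simp [poch, Finset.prod_range_succ']
  simp [cosCoeff, this]

/-- A form of Raabe's test. -/
lemma summable_of_raabe {a : ℕ → ℝ} (ha : ∀ n, 0 ≤ a n) (M : ℕ)
    (h : ∀ n, M ≤ n → a n + 4 * (n + 1) * a (n + 1) ≤ 4 * n * a n) : Summable a := by
  rw [← summable_nat_add_iff M]
  have key : ∀ n : ℕ, ∑ i ∈ Finset.range n, a (i + M) + 4 * ((n + M : ℕ) : ℝ) * a (n + M)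
      ≤ 4 * M * a M := by
    intro n
    induction n with
    | zero => simp
    | succ n ih =>
      have := h (n + M) (Nat.le_add_left _ _)
      rw [Finset.sum_range_succ, show n + 1 + M = n + M + 1 by ring]
      push_cast at *
      linarith
  refine summable_of_sum_range_le (fun n => ha _) (c := 4 * M * a M) fun n => ?_
  have := key n
  have h0 : 0 ≤ 4 * ((n + M : ℕ) : ℝ) * a (n + M) := by
    have := ha (n + M)
    positivity
  linarith

lemma summable_norm_cosCoeff (ν : ℂ) : Summable fun n => ‖cosCoeff ν n‖ := by
  refine summable_of_raabe (fun n => norm_nonneg _) (⌈‖ν‖ ^ 2⌉₊ + 1) fun n hn => ?_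
  have hn' : ‖ν‖ ^ 2 + 1 ≤ n := by
    have := Nat.le_ceil (‖ν‖ ^ 2)
    have h2 : ((⌈‖ν‖ ^ 2⌉₊ + 1 : ℕ) : ℝ) ≤ n := by exact_mod_cast hn
    push_cast at h2
    linarith
  have h1 := congrArg norm (cosCoeff_succ ν n)
  have e : ‖((2 * n + 2) * (2 * n + 1) : ℂ)‖ = (2 * n + 2) * (2 * n + 1) := by
    have : ((2 * n + 2) * (2 * n + 1) : ℂ) = (((2 * n + 2) * (2 * n + 1) : ℕ) : ℂ) := by
      push_cast
      ring
    rw [this, Complex.norm_natCast]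
    push_cast
    ring
  have h2 : ‖(4 * n ^ 2 - ν ^ 2 : ℂ)‖ ≤ 4 * n ^ 2 + ‖ν‖ ^ 2 := by
    refine (norm_sub_le _ _).trans ?_
    simp
  rw [norm_mul, norm_mul (cosCoeff ν n), e] at h1
  have h3 := mul_le_mul_of_nonneg_left h2 (norm_nonneg (cosCoeff ν n))
  have h4 := norm_nonneg (cosCoeff ν n)
  have hp : (0 : ℝ) < 2 * n + 1 := by positivity
  have h5 : 0 ≤ ‖cosCoeff ν n‖ * (n - ‖ν‖ ^ 2 - 1) := mul_nonneg h4 (by linarith)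
  have h6 : 0 ≤ ‖cosCoeff ν n‖ * ‖ν‖ ^ 2 := by positivity
  have h7 : 0 ≤ ‖cosCoeff ν n‖ * n := by positivity
  refine le_of_mul_le_mul_right ?_ hp
  nlinarith

lemma hasDerivAt_ofReal_sin (t : ℝ) :
    HasDerivAt (fun t : ℝ => Complex.sin t) (Complex.cos t) t :=
  (Complex.hasDerivAt_sin (t : ℂ)).comp_ofReal

lemma hasDerivAt_ofReal_cos (t : ℝ) :
    HasDerivAt (fun t : ℝ => Complex.cos t) (-Complex.sin t) t :=
  (Complex.hasDerivAt_cos (t : ℂ)).comp_ofReal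

/-- The partial sums of `₂F₁(-ν/2, ν/2; 1/2; sin² t)` solve `y'' + ν² y = 0` up to an explicit
residual. -/
lemma exists_hasDerivAt_partialSum (ν : ℂ) (N : ℕ) : ∃ D : ℝ → ℂ, D 0 = 0 ∧ ∀ t : ℝ,
    HasDerivAt (fun t : ℝ => ∑ n ∈ Finset.range (N + 1),
      cosCoeff ν n * (Complex.sin t ^ 2) ^ n) (D t) t ∧
    HasDerivAt D (-ν ^ 2 * (∑ n ∈ Finset.range (N + 1), cosCoeff ν n * (Complex.sin t ^ 2) ^ n)
      + cosCoeff ν N * (ν ^ 2 - 4 * N ^ 2) * (Complex.sin t ^ 2) ^ N) t := by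
  induction N with
  | zero =>
    refine ⟨fun _ => 0, rfl, fun t => ⟨?_, ?_⟩⟩
    · simpa using hasDerivAt_const t (cosCoeff ν 0)
    · exact (hasDerivAt_const t (0 : ℂ)).congr_deriv (by simp; ring)
  | succ N ih =>
    obtain ⟨D, hD0, hD⟩ := ih
    refine ⟨fun t => D t + cosCoeff ν (N + 1) *
      ((2 * N + 2) * (Complex.sin t ^ (2 * N + 1) * Complex.cos t)), by simp [hD0], fun t => ?_⟩
    obtain ⟨h1, h2⟩ := hD t
    have hs := hasDerivAt_ofReal_sin t
    have hc := hasDerivAt_ofReal_cos t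
    constructor
    · have := h1.add ((((hs.pow 2).pow (N + 1)).const_mul (cosCoeff ν (N + 1))))
      refine (this.congr_deriv ?_).congr_of_eventuallyEq (.of_forall fun t => ?_)
      · simp only [Pi.pow_apply, Nat.add_sub_cancel]
        push_cast
        ring
      · exact Finset.sum_range_succ _ _
    · have := h2.add ((((hs.pow (2 * N + 1)).mul hc).const_mul (2 * N + 2 : ℂ)).const_mul
        (cosCoeff ν (N + 1)))
      refine this.congr_deriv ?_
      rw [Finset.sum_range_succ _ (N + 1)]
      simp only [Pi.pow_apply, Nat.add_sub_cancel]
      have hr := cosCoeff_succ ν N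
      have hcs : Complex.cos t ^ 2 = 1 - Complex.sin t ^ 2 := Complex.cos_sq' _
      push_cast
      linear_combination (Complex.sin (t : ℂ) ^ 2) ^ N * hr + cosCoeff ν (N + 1) * (2 * N + 2) *
        (2 * N + 1) * (Complex.sin (t : ℂ) ^ 2) ^ N * hcs

lemma sin_sq_le_of_abs_le {t α : ℝ} (h : |t| ≤ |α|) (hα : |α| ≤ Real.pi / 2) :
    Real.sin t ^ 2 ≤ Real.sin α ^ 2 := by
  have h1 : Real.cos |α| ≤ Real.cos |t| :=
    Real.cos_le_cos_of_nonneg_of_le_pi (abs_nonneg _) (by linarith [Real.pi_pos]) h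
  rw [Real.cos_abs, Real.cos_abs] at h1
  have h2 : 0 ≤ Real.cos α := Real.cos_nonneg_of_mem_Icc (abs_le.1 hα |>.imp (by simp) id)
  nlinarith [Real.sin_sq_add_cos_sq t, Real.sin_sq_add_cos_sq α]

/-- Duhamel's formula bounds the error of the partial sums. -/
lemma norm_partialSum_sub_cos_le {ν : ℂ} (hν : ν ≠ 0) {α : ℝ} (hα : |α| ≤ Real.pi / 2) :
    ∃ K : ℝ, ∀ N : ℕ, ‖∑ n ∈ Finset.range (N + 1), cosCoeff ν n * (Complex.sin α ^ 2) ^ n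
      - Complex.cos (ν * α)‖ ≤
      ‖cosCoeff ν N‖ * (‖ν‖ ^ 2 + 4 * N ^ 2) * (Real.sin α ^ 2) ^ N * K := by
  obtain ⟨K, hK⟩ := (isCompact_uIcc (a := (0 : ℝ)) (b := α)).exists_bound_of_continuousOn
    (f := fun t : ℝ => Complex.sin (ν * (α - t)) / ν) (by fun_prop)
  refine ⟨K * |α|, fun N => ?_⟩
  obtain ⟨D, hD0, hD⟩ := exists_hasDerivAt_partialSum ν N
  set S : ℝ → ℂ := fun t : ℝ => ∑ n ∈ Finset.range (N + 1),
    cosCoeff ν n * (Complex.sin t ^ 2) ^ n with hS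
  set R : ℝ → ℂ := fun t => cosCoeff ν N * (ν ^ 2 - 4 * N ^ 2) * (Complex.sin t ^ 2) ^ N with hR
  have hS0 : S 0 = 1 := by
    simp [hS, Finset.sum_range_succ', cosCoeff_zero]
  have hlin (t : ℝ) : HasDerivAt (fun t : ℝ => ν * ((α : ℂ) - t)) (-ν) t := by
    simpa using ((Complex.ofRealCLM.hasDerivAt (x := t)).const_sub (α : ℂ)).const_mul ν
  have hG (t : ℝ) : HasDerivAt
      (fun t : ℝ => S t * Complex.cos (ν * (α - t)) + D t * (Complex.sin (ν * (α - t)) / ν))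
      (R t * (Complex.sin (ν * (α - t)) / ν)) t := by
    have hc := (Complex.hasDerivAt_cos _).comp t (hlin t)
    have hs := (Complex.hasDerivAt_sin _).comp t (hlin t)
    have := ((hD t).1.mul hc).add ((hD t).2.mul (hs.div_const ν))
    refine this.congr_deriv ?_
    simp only [Function.comp_apply, hS, hR]
    field_simp
    ring
  have hRle : ∀ t ∈ Set.uIcc 0 α, ‖R t * (Complex.sin (ν * (α - t)) / ν)‖ ≤
      ‖cosCoeff ν N‖ * (‖ν‖ ^ 2 + 4 * N ^ 2) * (Real.sin α ^ 2) ^ N * K := by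
    intro t ht
    rw [norm_mul]
    refine mul_le_mul ?_ (hK t ht) (norm_nonneg _) (by positivity)
    have ht' : |t| ≤ |α| := by
      simpa using Set.abs_sub_left_of_mem_uIcc ht
    have h1 : ‖(ν ^ 2 - 4 * N ^ 2 : ℂ)‖ ≤ ‖ν‖ ^ 2 + 4 * N ^ 2 := by
      refine (norm_sub_le _ _).trans ?_
      simp
    have h2 : ‖Complex.sin t‖ ^ 2 ≤ Real.sin α ^ 2 := by
      rw [← Complex.ofReal_sin, Complex.norm_real, Real.norm_eq_abs, sq_abs]
      exact sin_sq_le_of_abs_le ht' hα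
    simp only [hR, norm_mul, norm_pow]
    gcongr
  have := (convex_uIcc (0 : ℝ) α).norm_image_sub_le_of_norm_hasDerivWithin_le
    (fun t _ => (hG t).hasDerivWithinAt) hRle Set.left_mem_uIcc Set.right_mem_uIcc
  simpa [hD0, hS0, mul_assoc] using this

lemma summable_norm_cosCoeff_mul_pow (ν : ℂ) (α : ℝ) :
    Summable fun n => ‖cosCoeff ν n * ((Real.sin α : ℂ) ^ 2) ^ n‖ := by
  refine (summable_norm_cosCoeff ν).of_nonneg_of_le (fun n => norm_nonneg _) fun n => ?_
  rw [norm_mul, norm_pow, norm_pow, Complex.norm_real, Real.norm_eq_abs, sq_abs]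
  exact mul_le_of_le_one_right (norm_nonneg _)
    (pow_le_one₀ (sq_nonneg _) (Real.sin_sq_le_one α))

lemma cos_mul_eq_tsum_of_abs_lt (ν : ℂ) {α : ℝ} (hα : |α| < Real.pi / 2) :
    Complex.cos (ν * α) = ∑' n, cosCoeff ν n * ((Real.sin α : ℂ) ^ 2) ^ n := by
  rcases eq_or_ne ν 0 with rfl | hν
  · rw [tsum_eq_single 0]
    · simp [cosCoeff_zero]
    · intro n hn
      obtain ⟨m, rfl⟩ := Nat.exists_eq_succ_of_ne_zero hn
      simp [cosCoeff_zero_succ]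
  have hsum := ((summable_norm_cosCoeff_mul_pow ν α).of_norm.hasSum.tendsto_sum_nat).comp
    (tendsto_add_atTop_nat 1)
  refine tendsto_nhds_unique ?_ hsum
  rw [tendsto_iff_norm_sub_tendsto_zero]
  obtain ⟨K, hK⟩ := norm_partialSum_sub_cos_le hν hα.le
  refine squeeze_zero (fun _ => norm_nonneg _) (fun N => ?_) (g := fun N : ℕ =>
    ‖cosCoeff ν N‖ * (‖ν‖ ^ 2 + 4 * N ^ 2) * (Real.sin α ^ 2) ^ N * K) ?_
  · simpa using hK N
  · have hx : |Real.sin α ^ 2| < 1 := by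
      have : 0 < Real.cos α := Real.cos_pos_of_mem_Ioo (abs_lt.1 hα |>.imp (by simp) id)
      rw [abs_of_nonneg (sq_nonneg _)]
      nlinarith [Real.sin_sq_add_cos_sq α]
    have h0 := (summable_norm_cosCoeff ν).tendsto_atTop_zero
    have h1 := tendsto_pow_const_mul_const_pow_of_abs_lt_one 0 hx
    have h2 := tendsto_pow_const_mul_const_pow_of_abs_lt_one 2 hx
    have := (h0.mul ((h1.const_mul (‖ν‖ ^ 2)).add (h2.const_mul 4))).mul_const K
    simp only [mul_zero, add_zero, zero_mul] at this
    refine this.congr fun N => ?_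
    ring

lemma cos_mul_eq_tsum (ν : ℂ) {α : ℝ} (hα : |α| ≤ Real.pi / 2) :
    Complex.cos (ν * α) = ∑' n, cosCoeff ν n * ((Real.sin α : ℂ) ^ 2) ^ n := by
  have hcont : Continuous fun t : ℝ => ∑' n, cosCoeff ν n * ((Real.sin t : ℂ) ^ 2) ^ n := by
    refine continuous_tsum (fun n => by fun_prop) (summable_norm_cosCoeff ν) fun n t => ?_
    rw [norm_mul, norm_pow, norm_pow, Complex.norm_real, Real.norm_eq_abs, sq_abs]
    exact mul_le_of_le_one_right (norm_nonneg _)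
      (pow_le_one₀ (sq_nonneg _) (Real.sin_sq_le_one t))
  have heq : Set.EqOn (fun t : ℝ => Complex.cos (ν * t))
      (fun t : ℝ => ∑' n, cosCoeff ν n * ((Real.sin t : ℂ) ^ 2) ^ n)
      (Set.Ioo (-(Real.pi / 2)) (Real.pi / 2)) :=
    fun t ht => cos_mul_eq_tsum_of_abs_lt ν (abs_lt.2 ht)
  have := heq.closure (by fun_prop) hcont
  rw [closure_Ioo (by linarith [Real.pi_pos])] at this
  exact this (abs_le.1 hα)

/-- For every `ν ∈ ℂ` and real `α` with `|α| ≤ π/2`: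
`cos(να) = ₂F₁(-ν/2, ν/2; 1/2; sin²α)`, the hypergeometric series converging absolutely. -/
theorem stmt18 (ν : ℂ) (α : ℝ) (hα : |α| ≤ Real.pi / 2) :
    Summable (fun n : ℕ => ‖poch (-ν / 2) n * poch (ν / 2) n /
      (poch (1 / 2) n * (n.factorial : ℂ)) * (((Real.sin α : ℂ)) ^ 2) ^ n‖) ∧
    Complex.cos (ν * α) = F21 (-ν / 2) (ν / 2) (1 / 2) ((Real.sin α : ℂ) ^ 2) := by
  exact ⟨summable_norm_cosCoeff_mul_pow ν α, cos_mul_eq_tsum ν hα⟩
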